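/- Let N, K be positive integers, A ∈ ℝ^{N×N} and λ₀ > 0. Define g(U,Z) = (1/2)‖A − UZ‖_F² + (λ₀/2)‖U − Zᵀ‖_F² for U ∈ ℝ^{N×K}, Z ∈ ℝ^{K×N}, and the kernel h_d(U,Z) = 3·((‖U‖_F² + ‖Z‖_F²)/2)² + (‖A‖_F + 2λ₀)·(‖U‖_F² + ‖Z‖_F²)/2. Then there exists a constant L ≥ 1 such that both (U,Z) ↦ L·h_d(U,Z) − g(U,Z) and (U,Z) ↦ L·h_d(U,Z) + g(U,Z) are convex on ℝ^{N×K} × ℝ^{K×N}. -/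

import Mathlib

open Matrix

/-- Frobenius inner product of real matrices. -/
noncomputable def fip {m n : ℕ} (X Y : Matrix (Fin m) (Fin n) ℝ) : ℝ :=
  ∑ i, ∑ j, X i j * Y i j

/-- Frobenius norm of a real matrix. -/
noncomputable def fnorm {m n : ℕ} (X : Matrix (Fin m) (Fin n) ℝ) : ℝ :=
  Real.sqrt (fip X X)

lemma convexOn_univ_of_isLinearMap_minorant {E : Type*} [AddCommGroup E] [Module ℝ E]
    (f : E → ℝ) (l : E → E → ℝ) (hl : ∀ z, IsLinearMap ℝ (l z))
    (h : ∀ z d, f z + l z d ≤ f (z + d)) : ConvexOn ℝ Set.univ f := by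
  refine ⟨convex_univ, fun x _ y _ a b ha hb hab => ?_⟩
  set z := a • x + b • y with hz
  have hx := h z (x - z)
  have hy := h z (y - z)
  rw [add_sub_cancel] at hx hy
  have h0 : a * l z (x - z) + b * l z (y - z) = 0 := by
    have hc : a • (x - z) + b • (y - z) = 0 := by
      have : a • (x - z) + b • (y - z) = z - (a + b) • z := by rw [hz]; module
      rw [this, hab, one_smul, sub_self]
    rw [← smul_eq_mul, ← smul_eq_mul, ← (hl z).map_smul, ← (hl z).map_smul, ← (hl z).map_add, hc,
      (hl z).map_zero]
  have hfz : (a + b) * f z = f z := by rw [hab, one_mul]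
  simp only [smul_eq_mul]
  linarith [mul_le_mul_of_nonneg_left hx ha, mul_le_mul_of_nonneg_left hy hb]

section Frobenius

variable {m n k : ℕ}

lemma fip_comm (X Y : Matrix (Fin m) (Fin n) ℝ) : fip X Y = fip Y X := by
  simp only [fip, mul_comm]

lemma fip_add_right (X Y Z : Matrix (Fin m) (Fin n) ℝ) : fip X (Y + Z) = fip X Y + fip X Z := by
  simp only [fip, Matrix.add_apply, mul_add, Finset.sum_add_distrib]

lemma fip_smul_right (c : ℝ) (X Y : Matrix (Fin m) (Fin n) ℝ) : fip X (c • Y) = c * fip X Y := by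
  simp only [fip, Matrix.smul_apply, smul_eq_mul, Finset.mul_sum, mul_left_comm]

lemma fip_sub_right (X Y Z : Matrix (Fin m) (Fin n) ℝ) : fip X (Y - Z) = fip X Y - fip X Z := by
  simp only [fip, Matrix.sub_apply, mul_sub, Finset.sum_sub_distrib]

lemma fip_add_left (X Y Z : Matrix (Fin m) (Fin n) ℝ) : fip (X + Y) Z = fip X Z + fip Y Z := by
  rw [fip_comm, fip_add_right, fip_comm Z X, fip_comm Z Y]

lemma fip_sub_left (X Y Z : Matrix (Fin m) (Fin n) ℝ) : fip (X - Y) Z = fip X Z - fip Y Z := by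
  rw [fip_comm, fip_sub_right, fip_comm Z X, fip_comm Z Y]

lemma fip_self_nonneg (X : Matrix (Fin m) (Fin n) ℝ) : 0 ≤ fip X X :=
  Finset.sum_nonneg fun _ _ => Finset.sum_nonneg fun _ _ => mul_self_nonneg _

lemma fnorm_nonneg (X : Matrix (Fin m) (Fin n) ℝ) : 0 ≤ fnorm X := Real.sqrt_nonneg _

lemma fnorm_sq (X : Matrix (Fin m) (Fin n) ℝ) : fnorm X ^ 2 = fip X X :=
  Real.sq_sqrt (fip_self_nonneg X)

lemma fnorm_transpose (X : Matrix (Fin m) (Fin n) ℝ) : fnorm Xᵀ = fnorm X := by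
  unfold fnorm fip
  rw [Finset.sum_comm]
  rfl

lemma abs_fip_le (X Y : Matrix (Fin m) (Fin n) ℝ) : |fip X Y| ≤ fnorm X * fnorm Y := by
  refine abs_le_of_sq_le_sq ?_ (mul_nonneg (fnorm_nonneg X) (fnorm_nonneg Y))
  rw [mul_pow, fnorm_sq, fnorm_sq]
  simp only [fip, ← Fintype.sum_prod_type', ← sq]
  exact Finset.sum_mul_sq_le_sq_mul_sq _ _ _

lemma fnorm_mul_le (X : Matrix (Fin m) (Fin n) ℝ) (Y : Matrix (Fin n) (Fin k) ℝ) :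
    fnorm (X * Y) ≤ fnorm X * fnorm Y := by
  refine (sq_le_sq₀ (fnorm_nonneg _) (mul_nonneg (fnorm_nonneg X) (fnorm_nonneg Y))).1 ?_
  rw [mul_pow, ← fnorm_transpose Y, fnorm_sq, fnorm_sq, fnorm_sq]
  simp only [fip, Finset.sum_mul_sum, Matrix.transpose_apply, ← sq]
  refine Finset.sum_le_sum fun i _ => Finset.sum_le_sum fun j _ => ?_
  rw [← Finset.sum_mul_sum, Matrix.mul_apply]
  exact Finset.sum_mul_sq_le_sq_mul_sq _ _ _

lemma fnorm_add_sq_le (X Y : Matrix (Fin m) (Fin n) ℝ) :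
    fnorm (X + Y) ^ 2 ≤ 2 * (fnorm X ^ 2 + fnorm Y ^ 2) := by
  have h := fip_self_nonneg (X - Y)
  simp only [fnorm_sq, fip_add_left, fip_add_right, fip_sub_left, fip_sub_right] at h ⊢
  linarith

lemma fnorm_sub_sq_le (X Y : Matrix (Fin m) (Fin n) ℝ) :
    fnorm (X - Y) ^ 2 ≤ 2 * (fnorm X ^ 2 + fnorm Y ^ 2) := by
  have h := fip_self_nonneg (X + Y)
  simp only [fnorm_sq, fip_add_left, fip_add_right, fip_sub_left, fip_sub_right] at h ⊢
  linarith

lemma fnorm_sq_add (X Y : Matrix (Fin m) (Fin n) ℝ) :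
    fnorm (X + Y) ^ 2 = fnorm X ^ 2 + 2 * fip X Y + fnorm Y ^ 2 := by
  simp only [fnorm_sq, fip_add_left, fip_add_right, fip_comm Y X]
  ring

lemma fnorm_sq_sub (X Y : Matrix (Fin m) (Fin n) ℝ) :
    fnorm (X - Y) ^ 2 = fnorm X ^ 2 - 2 * fip X Y + fnorm Y ^ 2 := by
  simp only [fnorm_sq, fip_sub_left, fip_sub_right, fip_comm Y X]
  ring

end Frobenius

section Factorization

variable {N K : ℕ}

/-- The first-order Taylor remainder of
`(U, Z) ↦ ½‖A − UZ‖² + (c/2)‖U − Zᵀ‖²` at `(U, Z)` in the direction `(V, W)`. -/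
noncomputable def factorizationRemainder (A : Matrix (Fin N) (Fin N) ℝ) (c : ℝ)
    (U V : Matrix (Fin N) (Fin K) ℝ) (Z W : Matrix (Fin K) (Fin N) ℝ) : ℝ :=
  (1 / 2) * fnorm (U * W + V * Z + V * W) ^ 2 - fip (A - U * Z) (V * W) +
    (c / 2) * fnorm (V - Wᵀ) ^ 2

lemma factorization_taylor (A : Matrix (Fin N) (Fin N) ℝ) (c : ℝ)
    (U V : Matrix (Fin N) (Fin K) ℝ) (Z W : Matrix (Fin K) (Fin N) ℝ) :
    (1 / 2) * fnorm (A - (U + V) * (Z + W)) ^ 2 + (c / 2) * fnorm (U + V - (Z + W)ᵀ) ^ 2 =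
      (1 / 2) * fnorm (A - U * Z) ^ 2 + (c / 2) * fnorm (U - Zᵀ) ^ 2 +
      (c * fip (U - Zᵀ) (V - Wᵀ) - fip (A - U * Z) (U * W + V * Z)) +
      factorizationRemainder A c U V Z W := by
  have h1 : A - (U + V) * (Z + W) = (A - U * Z) - (U * W + V * Z + V * W) := by
    rw [Matrix.add_mul, Matrix.mul_add, Matrix.mul_add]; abel
  have h2 : U + V - (Z + W)ᵀ = (U - Zᵀ) + (V - Wᵀ) := by
    rw [Matrix.transpose_add]; abel
  rw [h1, h2, fnorm_sq_sub, fnorm_sq_add (U - Zᵀ),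
    fip_add_right _ (U * W + V * Z) (V * W),
    factorizationRemainder]
  ring

lemma abs_factorizationRemainder_le (A : Matrix (Fin N) (Fin N) ℝ) {c : ℝ} (hc : 0 ≤ c)
    (U V : Matrix (Fin N) (Fin K) ℝ) (Z W : Matrix (Fin K) (Fin N) ℝ) :
    |factorizationRemainder A c U V Z W| ≤
      (9 / 4) * ((fnorm U ^ 2 + fnorm Z ^ 2) * (fnorm V ^ 2 + fnorm W ^ 2)) +
      (1 / 4) * (fnorm V ^ 2 + fnorm W ^ 2) ^ 2 +
      (fnorm A / 2 + c) * (fnorm V ^ 2 + fnorm W ^ 2) := by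
  have hA := fnorm_nonneg A
  have hUW := pow_le_pow_left₀ (fnorm_nonneg _) (fnorm_mul_le U W) 2
  have hVZ := pow_le_pow_left₀ (fnorm_nonneg _) (fnorm_mul_le V Z) 2
  have hvw : fnorm (V * W) ≤ (fnorm V ^ 2 + fnorm W ^ 2) / 2 := by
    linarith [fnorm_mul_le V W, two_mul_le_add_sq (fnorm V) (fnorm W)]
  have huz : fnorm (U * Z) ≤ (fnorm U ^ 2 + fnorm Z ^ 2) / 2 := by
    linarith [fnorm_mul_le U Z, two_mul_le_add_sq (fnorm U) (fnorm Z)]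
  have hVW := pow_le_pow_left₀ (fnorm_nonneg _) hvw 2
  have hE := fnorm_add_sq_le (U * W) (V * Z)
  have hE' := fnorm_add_sq_le (U * W + V * Z) (V * W)
  have hAVW := (abs_fip_le A (V * W)).trans (mul_le_mul_of_nonneg_left hvw hA)
  have hUZVW := (abs_fip_le (U * Z) (V * W)).trans
    (mul_le_mul huz hvw (fnorm_nonneg _) (by positivity))
  have hT := fnorm_sub_sq_le V Wᵀ
  rw [fnorm_transpose] at hT
  have hcT := mul_le_mul_of_nonneg_left hT (div_nonneg hc zero_le_two)
  have hcT0 : 0 ≤ c / 2 * fnorm (V - Wᵀ) ^ 2 := by positivity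
  have hcross : 0 ≤ fnorm U ^ 2 * fnorm V ^ 2 + fnorm Z ^ 2 * fnorm W ^ 2 := by positivity
  have hS := sq_nonneg (fnorm (U * W + V * Z + V * W))
  have hac : 0 ≤ (fnorm U ^ 2 + fnorm Z ^ 2) * (fnorm V ^ 2 + fnorm W ^ 2) := by positivity
  have hcc : 0 ≤ c * (fnorm V ^ 2 + fnorm W ^ 2) := by positivity
  have hc2 := sq_nonneg (fnorm V ^ 2 + fnorm W ^ 2)
  rw [abs_le] at hAVW hUZVW
  rw [factorizationRemainder, fip_sub_left, abs_le]
  constructor <;> nlinarith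

lemma quartic_remainder_lower_bound {a b c : ℝ} (h : b ^ 2 ≤ a * c) :
    (9 / 4) * (a * c) + (1 / 4) * c ^ 2 ≤ 3 * (3 / 4 * (2 * (a * c) + (2 * b + c) ^ 2)) := by
  nlinarith [sq_nonneg (4 * b + c), sq_nonneg (2 * b + c)]

lemma fip_add_fip_sq_le (U V : Matrix (Fin N) (Fin K) ℝ) (Z W : Matrix (Fin K) (Fin N) ℝ) :
    (fip U V + fip Z W) ^ 2 ≤ (fnorm U ^ 2 + fnorm Z ^ 2) * (fnorm V ^ 2 + fnorm W ^ 2) := by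
  have h : |fip U V + fip Z W| ≤ fnorm U * fnorm V + fnorm Z * fnorm W :=
    (abs_add_le _ _).trans (add_le_add (abs_fip_le U V) (abs_fip_le Z W))
  have h2 := pow_le_pow_left₀ (abs_nonneg _) h 2
  rw [sq_abs] at h2
  nlinarith [sq_nonneg (fnorm U * fnorm W - fnorm Z * fnorm V)]

lemma convexOn_kernel_add_mul_factorization (A : Matrix (Fin N) (Fin N) ℝ) {c s : ℝ}
    (hc : 0 ≤ c) (hs : |s| ≤ 1) :
    ConvexOn ℝ Set.univ
      (fun p : Matrix (Fin N) (Fin K) ℝ × Matrix (Fin K) (Fin N) ℝ =>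
        3 * (3 * ((fnorm p.1 ^ 2 + fnorm p.2 ^ 2) / 2) ^ 2 +
             (fnorm A + 2 * c) * ((fnorm p.1 ^ 2 + fnorm p.2 ^ 2) / 2)) +
        s * ((1 / 2) * fnorm (A - p.1 * p.2) ^ 2 + (c / 2) * fnorm (p.1 - p.2ᵀ) ^ 2)) := by
  refine convexOn_univ_of_isLinearMap_minorant _
    (fun p d => 3 * (3 * (fnorm p.1 ^ 2 + fnorm p.2 ^ 2) + (fnorm A + 2 * c)) *
        (fip p.1 d.1 + fip p.2 d.2) +
      s * (c * fip (p.1 - p.2ᵀ) (d.1 - d.2ᵀ) -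
        fip (A - p.1 * p.2) (p.1 * d.2 + d.1 * p.2))) ?_ ?_
  · rintro ⟨U, Z⟩
    constructor
    · rintro ⟨V, W⟩ ⟨V', W'⟩
      simp only [Prod.mk_add_mk, Matrix.transpose_add, Matrix.mul_add, Matrix.add_mul,
        fip_add_right, fip_sub_right]
      ring
    · rintro r ⟨V, W⟩
      simp only [Prod.smul_mk, Matrix.transpose_smul, Matrix.mul_smul, Matrix.smul_mul,
        fip_add_right, fip_sub_right, fip_smul_right, smul_eq_mul]
      ring
  · rintro ⟨U, Z⟩ ⟨V, W⟩
    simp only [Prod.mk_add_mk]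
    rw [factorization_taylor, fnorm_sq_add U V, fnorm_sq_add Z W]
    have hR := abs_factorizationRemainder_le A hc U V Z W
    have hsR : -|factorizationRemainder A c U V Z W| ≤ s * factorizationRemainder A c U V Z W := by
      refine le_trans (neg_le_neg ?_) (neg_abs_le _)
      rw [abs_mul]
      exact mul_le_of_le_one_left (abs_nonneg _) hs
    have hq := quartic_remainder_lower_bound (fip_add_fip_sq_le U V Z W)
    have hA : 0 ≤ (fnorm A / 2 + c) * (fnorm V ^ 2 + fnorm W ^ 2) := by
      have := fnorm_nonneg A
      positivity
    linarith

end Factorization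

/-- for g(U,Z) = ½‖A − UZ‖_F² + (lam₀/2)‖U − Zᵀ‖_F² and kernel
h_d(U,Z) = 3((‖U‖²+‖Z‖²)/2)² + (‖A‖_F + 2lam₀)(‖U‖²+‖Z‖²)/2, there is L ≥ 1 such that
both L·h_d − g and L·h_d + g are convex. -/
theorem stmt18 (N K : ℕ) (hN : 0 < N) (hK : 0 < K)
    (A : Matrix (Fin N) (Fin N) ℝ) (lam₀ : ℝ) (hlam₀ : 0 < lam₀) :
    ∃ L : ℝ, 1 ≤ L ∧
      ConvexOn ℝ Set.univ
        (fun p : Matrix (Fin N) (Fin K) ℝ × Matrix (Fin K) (Fin N) ℝ =>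
          L * (3 * ((fnorm p.1 ^ 2 + fnorm p.2 ^ 2) / 2) ^ 2 +
               (fnorm A + 2 * lam₀) * ((fnorm p.1 ^ 2 + fnorm p.2 ^ 2) / 2)) -
          ((1 / 2) * fnorm (A - p.1 * p.2) ^ 2 +
            (lam₀ / 2) * fnorm (p.1 - p.2ᵀ) ^ 2)) ∧
      ConvexOn ℝ Set.univ
        (fun p : Matrix (Fin N) (Fin K) ℝ × Matrix (Fin K) (Fin N) ℝ =>
          L * (3 * ((fnorm p.1 ^ 2 + fnorm p.2 ^ 2) / 2) ^ 2 +
               (fnorm A + 2 * lam₀) * ((fnorm p.1 ^ 2 + fnorm p.2 ^ 2) / 2)) +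
          ((1 / 2) * fnorm (A - p.1 * p.2) ^ 2 +
            (lam₀ / 2) * fnorm (p.1 - p.2ᵀ) ^ 2)) := by
  refine ⟨3, by norm_num, ?_, ?_⟩
  · simpa only [neg_one_mul, ← sub_eq_add_neg] using
      convexOn_kernel_add_mul_factorization (K := K) A (s := -1) hlam₀.le (by norm_num)
  · simpa only [one_mul] using
      convexOn_kernel_add_mul_factorization (K := K) A (s := 1) hlam₀.le (by norm_num)
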